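/- Let f₁,…,f_k ∈ P be nonzero, V = {(u,v) ∈ Pᵏ × P : u₁f₁ + ⋯ + u_kf_k = v}, and let G = {(u₁,v₁),…,(u_m,v_m)} ⊂ V be a strong involutive basis w.r.t. Pommaret division. Then G₁ = {v_i : v_i ≠ 0} is an involutive basis of I = ⟨f₁,…,f_k⟩ in the sense that for every nonzero f ∈ I there exists v ∈ G₁ with lm(v) Pommaret-dividing lm(f). -/

import Mathlib

open MvPolynomial Finsupp

/-- Monomials in `n` variables, identified with their exponent vectors. -/
abbrev Mon (n : ℕ) := Fin n →₀ ℕ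

/-- Total degree of a monomial. -/
def mdeg {n : ℕ} (u : Mon n) : ℕ := u.sum fun _ e => e

/-- The strict degree reverse lexicographic order with `xₙ ≺ ⋯ ≺ x₁`
(the variable `xᵢ` of the paper corresponds to the index `i - 1 : Fin n`). -/
def drl {n : ℕ} (u v : Mon n) : Prop :=
  mdeg u < mdeg v ∨
    (mdeg u = mdeg v ∧ ∃ i : Fin n, v i < u i ∧ ∀ j : Fin n, i < j → u j = v j)

/-- The reflexive closure of `drl` (`⪯` for degrevlex). -/
def drle {n : ℕ} (u v : Mon n) : Prop := drl u v ∨ u = v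

/-- `m` is the degrevlex-leading monomial of `f`. -/
def IsLM {K : Type*} [Field K] {n : ℕ} (f : MvPolynomial (Fin n) K) (m : Mon n) : Prop :=
  m ∈ f.support ∧ ∀ m' ∈ f.support, m' = m ∨ drl m' m

/-- The degrevlex-leading monomial of `f` (junk value `0` for `f = 0`). -/
noncomputable def lm {K : Type*} [Field K] {n : ℕ} (f : MvPolynomial (Fin n) K) : Mon n := by
  classical exact if h : ∃ m, IsLM f m then h.choose else 0

/-- `xᵢ` is Pommaret-multiplicative for the monomial `u`, i.e. no variable strictly
larger in index (hence strictly smaller in the order `xₙ ≺ ⋯ ≺ x₁`) occurs in `u`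
beyond `xᵢ`; for `u = 1` every variable is multiplicative. -/
def PMult {n : ℕ} (u : Mon n) (i : Fin n) : Prop := ∀ j : Fin n, i < j → u j = 0

/-- `u` Pommaret-divides `w`: `w = u · m` for a monomial `m` involving only
Pommaret-multiplicative variables of `u`. -/
def PDiv {n : ℕ} (u w : Mon n) : Prop :=
  ∃ m : Mon n, w = u + m ∧ ∀ i : Fin n, m i ≠ 0 → PMult u i

/-- The strict Schreyer order on module monomials `x^α eᵢ` of `P^k` induced by the
tuple `f`: `(α, i) ≺ₛ (β, j)` iff `lm(x^α fᵢ) ≺ lm(x^β fⱼ)` or they are equal and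
`j < i`. -/
def SLT {K : Type*} [Field K] {n k : ℕ} (f : Fin k → MvPolynomial (Fin n) K)
    (a b : Mon n × Fin k) : Prop :=
  drl (lm (monomial a.1 (1 : K) * f a.2)) (lm (monomial b.1 (1 : K) * f b.2)) ∨
    (lm (monomial a.1 (1 : K) * f a.2) = lm (monomial b.1 (1 : K) * f b.2) ∧ b.2 < a.2)

/-- `mm` is the `≺ₛ`-leading module monomial of `U ∈ P^k`. -/
def IsLMs {K : Type*} [Field K] {n k : ℕ} (f : Fin k → MvPolynomial (Fin n) K)
    (U : Fin k → MvPolynomial (Fin n) K) (mm : Mon n × Fin k) : Prop :=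
  mm.1 ∈ (U mm.2).support ∧
    ∀ i : Fin k, ∀ m ∈ (U i).support, (m, i) = mm ∨ SLT f (m, i) mm

/-- The pair `p` belongs to the module `V = {(u, v) : u₁f₁ + ⋯ + uₖfₖ = v}`. -/
def InV {K : Type*} [Field K] {n k : ℕ} (f : Fin k → MvPolynomial (Fin n) K)
    (p : (Fin k → MvPolynomial (Fin n) K) × MvPolynomial (Fin n) K) : Prop :=
  ∑ i, p.1 i * f i = p.2

/-- `p` is involutively top-reducible by `q` (w.r.t. Pommaret division and the
Schreyer order attached to `f`). -/
def TopRed {K : Type*} [Field K] {n k : ℕ} (f : Fin k → MvPolynomial (Fin n) K)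
    (p q : (Fin k → MvPolynomial (Fin n) K) × MvPolynomial (Fin n) K) : Prop :=
  (q.2 ≠ 0 ∧ p.2 ≠ 0 ∧ PDiv (lm q.2) (lm p.2) ∧
    ∃ a b, IsLMs f (fun i => monomial (lm p.2 - lm q.2) (1 : K) * q.1 i) a ∧
      IsLMs f p.1 b ∧ (a = b ∨ SLT f a b)) ∨
  (q.2 = 0 ∧ q.1 ≠ 0 ∧ p.1 ≠ 0 ∧
    ∃ a b, IsLMs f q.1 a ∧ IsLMs f p.1 b ∧ a.2 = b.2 ∧ a.1 ≤ b.1)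

/-- `G` is a strong involutive basis of `V`: every nonzero pair in `V` is involutively
top-reducible by some pair in `G`. -/
def StrongInvBasis {K : Type*} [Field K] {n k : ℕ} (f : Fin k → MvPolynomial (Fin n) K)
    (G : Finset ((Fin k → MvPolynomial (Fin n) K) × MvPolynomial (Fin n) K)) : Prop :=
  ∀ p : (Fin k → MvPolynomial (Fin n) K) × MvPolynomial (Fin n) K, InV f p → p ≠ 0 → ∃ q ∈ G, TopRed f p q

theorem mdeg_eq_degree {n : ℕ} (u : Mon n) : mdeg u = u.degree := rfl

theorem drl_trans {n : ℕ} {u v w : Mon n} (huv : drl u v) (hvw : drl v w) : drl u w := by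
  rcases huv with h | ⟨h, i, hi, hi'⟩ <;> rcases hvw with h' | ⟨h', j, hj, hj'⟩
  · exact Or.inl (h.trans h')
  · exact Or.inl (h' ▸ h)
  · exact Or.inl (h ▸ h')
  · refine Or.inr ⟨h.trans h', max i j, ?_, fun l hl => ?_⟩
    · rcases lt_trichotomy i j with hij | rfl | hij
      · rw [max_eq_right hij.le, hi' j hij]
        exact hj
      · rw [max_self]
        exact hj.trans hi
      · rw [max_eq_left hij.le, ← hj' i hij]
        exact hi
    · rw [hi' l ((le_max_left _ _).trans_lt hl), hj' l ((le_max_right _ _).trans_lt hl)]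

theorem drl_irrefl {n : ℕ} (u : Mon n) : ¬ drl u u := by
  rintro (h | ⟨-, i, hi, -⟩)
  · exact lt_irrefl _ h
  · exact lt_irrefl _ hi

theorem drl_trichotomous {n : ℕ} (u v : Mon n) : drl u v ∨ u = v ∨ drl v u := by
  classical
  rcases lt_trichotomy (mdeg u) (mdeg v) with h | h | h
  · exact Or.inl (Or.inl h)
  · by_cases huv : u = v
    · exact Or.inr (Or.inl huv)
    · have hne : (Finset.univ.filter fun i => u i ≠ v i).Nonempty := by
        obtain ⟨i, hi⟩ := DFunLike.ne_iff.mp huv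
        exact ⟨i, by simpa using hi⟩
      obtain ⟨i, hi, hmax⟩ := Finset.exists_max_image _ id hne
      have heq : ∀ j, i < j → u j = v j := fun j hj => by
        by_contra hc
        exact (hmax j (by simpa using hc)).not_gt hj
      rcases lt_or_gt_of_ne (Finset.mem_filter.mp hi).2 with hlt | hlt
      · exact Or.inr (Or.inr (Or.inr ⟨h.symm, i, hlt, fun j hj => (heq j hj).symm⟩))
      · exact Or.inl (Or.inr ⟨h, i, hlt, heq⟩)
  · exact Or.inr (Or.inr (Or.inl h))

theorem drl_add_left {n : ℕ} (w : Mon n) {u v : Mon n} (h : drl u v) : drl (w + u) (w + v) := by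
  simp only [drl, mdeg_eq_degree, map_add, add_lt_add_iff_left, add_right_inj,
    Finsupp.add_apply] at h ⊢
  exact h

theorem drl_wellFounded (n : ℕ) : WellFounded (drl (n := n)) := by
  have hfin : ∀ v : Mon n, {u | drl u v}.Finite := fun v =>
    (Finsupp.finite_of_degree_le (mdeg v)).subset fun u hu => by
      rcases hu with h | ⟨h, -⟩
      · exact h.le
      · exact h.le
  refine Subrelation.wf (r := InvImage (· < ·) fun v : Mon n => {u | drl u v}.ncard) ?_
    (InvImage.wf _ wellFounded_lt)
  intro u v huv
  exact Set.ncard_lt_ncard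
    ⟨fun w hw => drl_trans hw huv, fun hsub => drl_irrefl u (hsub huv)⟩ (hfin v)

section LeadingMonomial

variable {K : Type*} [Field K] {n k : ℕ}

theorem exists_drl_max (s : Finset (Mon n)) (hs : s.Nonempty) :
    ∃ m ∈ s, ∀ m' ∈ s, m' = m ∨ drl m' m := by
  induction hs using Finset.Nonempty.cons_induction with
  | singleton a => exact ⟨a, by simp, by simp⟩
  | cons a s ha hs ih =>
    obtain ⟨m, hm, hmax⟩ := ih
    rcases drl_trichotomous a m with h | rfl | h
    · exact ⟨m, by simp [hm], by simpa using ⟨Or.inr h, hmax⟩⟩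
    · exact absurd hm ha
    · refine ⟨a, by simp, fun m' hm' => ?_⟩
      rcases Finset.mem_cons.mp hm' with rfl | hm'
      · exact Or.inl rfl
      · rcases hmax m' hm' with rfl | h'
        · exact Or.inr h
        · exact Or.inr (drl_trans h' h)

theorem isLM_lm {p : MvPolynomial (Fin n) K} (hp : p ≠ 0) : IsLM p (lm p) := by
  have h : ∃ m, IsLM p m := exists_drl_max p.support (by simpa using hp)
  rw [lm, dif_pos h]
  exact h.choose_spec

theorem IsLM.unique {p : MvPolynomial (Fin n) K} {m m' : Mon n} (h : IsLM p m)
    (h' : IsLM p m') : m = m' := by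
  rcases h.2 m' h'.1 with rfl | hlt
  · rfl
  · rcases h'.2 m h.1 with rfl | hgt
    · rfl
    · exact absurd (drl_trans hlt hgt) (drl_irrefl _)

theorem mem_support_monomial_mul {a m : Mon n} {c : K} {p : MvPolynomial (Fin n) K}
    (h : m ∈ (monomial a c * p).support) : ∃ m' ∈ p.support, m = a + m' := by
  rw [MvPolynomial.mem_support_iff, coeff_monomial_mul'] at h
  split_ifs at h with ham
  · exact ⟨m - a, MvPolynomial.mem_support_iff.mpr (right_ne_zero_of_mul h),
      (add_tsub_cancel_of_le ham).symm⟩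
  · exact absurd rfl h

theorem lm_monomial_mul (a : Mon n) {p : MvPolynomial (Fin n) K} (hp : p ≠ 0) :
    lm (monomial a (1 : K) * p) = a + lm p := by
  have hlm := isLM_lm hp
  have h : IsLM (monomial a (1 : K) * p) (a + lm p) := by
    refine ⟨?_, fun m hm => ?_⟩
    · rw [MvPolynomial.mem_support_iff, coeff_monomial_mul, one_mul]
      exact MvPolynomial.mem_support_iff.mp hlm.1
    · obtain ⟨m', hm', rfl⟩ := mem_support_monomial_mul hm
      rcases hlm.2 m' hm' with rfl | hlt
      · exact Or.inl rfl
      · exact Or.inr (drl_add_left a hlt)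
  refine (isLM_lm fun h0 => ?_).unique h
  simpa [h0] using h.1

theorem SLT_wellFounded (f : Fin k → MvPolynomial (Fin n) K) : WellFounded (SLT f) := by
  refine Subrelation.wf (r := InvImage (Prod.Lex drl fun i j : Fin k => j < i)
    fun a : Mon n × Fin k => (lm (monomial a.1 (1 : K) * f a.2), a.2)) ?_
    (InvImage.wf _ ((drl_wellFounded n).prod_lex wellFounded_gt))
  intro a b h
  exact Prod.lex_def.mpr h

theorem SLT_add_left {f : Fin k → MvPolynomial (Fin n) K} (hf : ∀ i, f i ≠ 0) (w : Mon n)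
    {a b : Mon n × Fin k} (h : SLT f a b) : SLT f (w + a.1, a.2) (w + b.1, b.2) := by
  simp only [SLT, lm_monomial_mul _ (hf _), add_assoc] at h ⊢
  exact h.imp (drl_add_left w) fun h' => ⟨by rw [h'.1], h'.2⟩

theorem IsLMs.unique {f U : Fin k → MvPolynomial (Fin n) K} {a b : Mon n × Fin k}
    (ha : IsLMs f U a) (hb : IsLMs f U b) : a = b := by
  rcases ha.2 _ _ hb.1 with h | hlt
  · exact h.symm
  · rcases hb.2 _ _ ha.1 with h | hgt
    · exact h
    · exact absurd hgt ((SLT_wellFounded f).asymmetric _ _ hlt)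

/-- Cancelling the leading module monomial of `U` by a multiple of `W` strictly lowers it. -/
theorem IsLMs.sub_monomial_mul_lt {f U W : Fin k → MvPolynomial (Fin n) K}
    (hf : ∀ i, f i ≠ 0) {a b d : Mon n × Fin k} (hU : IsLMs f U b) (hW : IsLMs f W a)
    (hi : a.2 = b.2) (hle : a.1 ≤ b.1)
    (hd : d.1 ∈ (U d.2 - monomial (b.1 - a.1) (coeff b.1 (U b.2) / coeff a.1 (W a.2)) *
      W d.2).support) : SLT f d b := by
  classical
  have hab : b.1 - a.1 + a.1 = b.1 := tsub_add_cancel_of_le hle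
  have hor : d = b ∨ SLT f d b := by
    rcases Finset.mem_union.mp (support_sub _ _ _ hd) with h | h
    · exact hU.2 _ _ h
    · obtain ⟨m, hm, hdm⟩ := mem_support_monomial_mul h
      rcases hW.2 _ _ hm with rfl | hlt
      · exact Or.inl (Prod.ext (hdm.trans hab) hi)
      · have := SLT_add_left hf (b.1 - a.1) hlt
        rw [hab, hi] at this
        simp only [← hdm] at this
        exact Or.inr this
  refine hor.resolve_left ?_
  rintro rfl
  have hne : coeff a.1 (W a.2) ≠ 0 := MvPolynomial.mem_support_iff.mp hW.1
  refine MvPolynomial.mem_support_iff.mp hd ?_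
  have hcoeff := coeff_monomial_mul a.1 (d.1 - a.1)
    (coeff d.1 (U d.2) / coeff a.1 (W a.2)) (W a.2)
  rw [hab, div_mul_cancel₀ _ hne, ← hi] at hcoeff
  rw [coeff_sub, sub_eq_zero, ← hi]
  exact hcoeff.symm

theorem TopRed.exists_isLMs {f : Fin k → MvPolynomial (Fin n) K}
    {p q : (Fin k → MvPolynomial (Fin n) K) × MvPolynomial (Fin n) K} (h : TopRed f p q) :
    ∃ b, IsLMs f p.1 b := by
  rcases h with ⟨-, -, -, -, b, -, hb, -⟩ | ⟨-, -, -, -, b, -, hb, -⟩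
  · exact ⟨b, hb⟩
  · exact ⟨b, hb⟩

end LeadingMonomial

/-- if `G` is a strong involutive basis of
`V = {(u, v) : u₁f₁ + ⋯ + uₖfₖ = v}`, then `G₁ = {v : (u, v) ∈ G, v ≠ 0}` is a
Pommaret involutive basis of the ideal `⟨f₁, …, fₖ⟩`. -/
theorem statement8 {K : Type*} [Field K] {n k : ℕ}
    (f : Fin k → MvPolynomial (Fin n) K) (hf : ∀ i, f i ≠ 0)
    (G : Finset ((Fin k → MvPolynomial (Fin n) K) × MvPolynomial (Fin n) K))
    (hGV : ∀ g ∈ G, InV f g)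
    (hSB : StrongInvBasis f G) :
    ∀ q ∈ Ideal.span (Set.range f), q ≠ 0 →
      ∃ g ∈ G, g.2 ≠ 0 ∧ PDiv (lm g.2) (lm q) := by
  intro q hq hq0
  have hne : ∀ U : Fin k → MvPolynomial (Fin n) K, (U, q) ≠ 0 := fun U h =>
    hq0 (congrArg Prod.snd h)
  have key : ∀ b U, IsLMs f U b → InV f (U, q) →
      ∃ g ∈ G, g.2 ≠ 0 ∧ PDiv (lm g.2) (lm q) := by
    intro b
    induction b using (SLT_wellFounded f).induction with
    | _ b ih =>
      intro U hU hUV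
      obtain ⟨g, hg, ⟨hg0, -, hdiv, -⟩ | ⟨hg0, -, -, a, b', ha, hb', hi, hle⟩⟩ :=
        hSB (U, q) hUV (hne U)
      · exact ⟨g, hg, hg0, hdiv⟩
      · obtain rfl := hb'.unique hU
        set t := monomial (b'.1 - a.1) (coeff b'.1 (U b'.2) / coeff a.1 (g.1 a.2))
        have hV : InV f (fun i => U i - t * g.1 i, q) := by
          have hgV : ∑ i, g.1 i * f i = 0 := (hGV g hg).trans hg0
          have hUV' : ∑ i, U i * f i = q := hUV
          simp only [InV, sub_mul, Finset.sum_sub_distrib, mul_assoc, ← Finset.mul_sum,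
            hgV, hUV', mul_zero, sub_zero]
        obtain ⟨g', -, hred⟩ := hSB _ hV (hne _)
        obtain ⟨d, hd⟩ := hred.exists_isLMs
        exact ih d (hU.sub_monomial_mul_lt hf ha hi hle hd.1) _ hd hV
  obtain ⟨U, hU⟩ := Ideal.mem_span_range_iff_exists_fun.mp hq
  obtain ⟨g, -, hred⟩ := hSB (U, q) hU (hne U)
  obtain ⟨b, hb⟩ := hred.exists_isLMs
  exact key b U hb hU
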